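/- Let q, x, y₁, y₂, z be complex numbers with |q| < 1 and |x|, |y₁|, |y₂|, |z| ≤ 1. Let 𝒜_{1,1̄,2,3̄} = {λ = (P,O) ∈ 𝒜 : 1 ∉ P, 2 ∉ P, 3 ∉ O} (the parts 1, 1̄, 2 and 3̄ are forbidden). Then Σ_{λ ∈ 𝒜_{1,1̄,2,3̄}} x^{♯(λ)} y₁^{♯_{2,4}(λ)} y₂^{♯_{0,4}(λ)} z^{𝖮(λ)} q^{|λ|} = Σ_{n₁,n₂,n₃,n₄ ≥ 0} x^{n₁+n₂+n₃+n₄} y₁^{n₃} y₂^{n₄} z^{n₂} q^{Q(n₁,n₂,n₃,n₄) + 3n₁ + 5n₂ + 6n₃ + 4n₄} / ((q²;q²)_{n₁}(q²;q²)_{n₂}(q⁴;q⁴)_{n₃}(q⁴;q⁴)_{n₄}), where both series converge absolutely. -/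

import Mathlib

/-- The finite q-Pochhammer symbol `(a; q)_n = ∏_{k=0}^{n-1} (1 - a q^k)`. -/
noncomputable def qPoch (a q : ℂ) (n : ℕ) : ℂ :=
  ∏ k ∈ Finset.range n, (1 - a * q ^ k)

/-- The quadratic form `Q(n₁,n₂,n₃,n₄)`. -/
def Qform (n₁ n₂ n₃ n₄ : ℕ) : ℕ :=
  4 * Nat.choose n₁ 2 + 6 * Nat.choose n₂ 2 + 4 * Nat.choose n₃ 2 + 8 * Nat.choose n₄ 2 +
    4 * (n₁ * n₂ + n₁ * n₃ + n₁ * n₄ + n₂ * n₃ + n₂ * n₄ + n₃ * n₄)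

/-- Membership in the set `𝒜`: an overpartition is a pair `(P, O)` with `P` a finite set of
positive integers (the parts) and `O ⊆ {p ∈ P : p odd}` (the overlined parts), such that any
two parts `a > b` differ by at least 4, and by at least 5 whenever `a` is overlined or
divisible by 4. -/
def MemA (P O : Finset ℕ) : Prop :=
  (∀ p ∈ P, 0 < p) ∧ O ⊆ P ∧ (∀ p ∈ O, Odd p) ∧
    ∀ a ∈ P, ∀ b ∈ P, b < a →
      4 ≤ a - b ∧ ((a ∈ O ∨ 4 ∣ a) → 5 ≤ a - b)

/-- `♯_{a,M}(λ)`: the number of parts of `λ` congruent to `a` modulo `M`. -/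
def countMod (a M : ℕ) (P : Finset ℕ) : ℕ := (P.filter fun p => p % M = a).card

/-- Any two elements `i < j` of `I` satisfy `i + d i ≤ j`. -/
def IsSpaced (d : ℕ → ℕ) (I : Finset ℕ) : Prop :=
  ∀ i ∈ I, ∀ j ∈ I, i < j → i + d i ≤ j

/-- The first index that may follow all elements of `I`. -/
def nextIndex (d : ℕ → ℕ) (I : Finset ℕ) : ℕ := I.sup fun i => i + d i

theorem isSpaced_insert_iff {d : ℕ → ℕ} {N : ℕ} {I : Finset ℕ} (hI : I ⊆ Finset.range N) :
    IsSpaced d (insert N I) ↔ IsSpaced d I ∧ nextIndex d I ≤ N := by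
  have hlt : ∀ i ∈ I, i < N := fun i hi => Finset.mem_range.1 (hI hi)
  simp only [IsSpaced, nextIndex, Finset.sup_le_iff, Finset.mem_insert]
  constructor
  · exact fun h => ⟨fun i hi j hj => h i (.inr hi) j (.inr hj),
      fun i hi => h i (.inr hi) N (.inl rfl) (hlt i hi)⟩
  · rintro ⟨h₁, h₂⟩ i (rfl | hi) j (rfl | hj) hij
    · exact absurd hij (lt_irrefl _)
    · exact absurd hij (hlt j hj).le.not_gt
    · exact h₂ i hi
    · exact h₁ i hi j hj hij

open Classical in
theorem eq_sum_isSpaced {w S : ℕ → ℂ} {d : ℕ → ℕ} (hd : ∀ i, 1 ≤ d i)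
    (hS : ∀ i, S i = w i * S (i + d i) + S (i + 1)) (N : ℕ) :
    S 0 = ∑ I ∈ (Finset.range N).powerset,
      if IsSpaced d I then (∏ i ∈ I, w i) * S (max N (nextIndex d I)) else 0 := by
  induction N with
  | zero => simp [IsSpaced, nextIndex]
  | succ N ih =>
    rw [ih, Finset.range_add_one, Finset.sum_powerset_insert Finset.notMem_range_self,
      ← Finset.sum_add_distrib]
    refine Finset.sum_congr rfl fun I hI => ?_
    have hI := Finset.mem_powerset.1 hI
    have hN : N ∉ I := fun h => Finset.notMem_range_self (hI h)
    have hd := hd N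
    rw [isSpaced_insert_iff hI, Finset.prod_insert hN]
    have hins : nextIndex d (insert N I) = max (N + d N) (nextIndex d I) := Finset.sup_insert
    rw [hins]
    by_cases h : IsSpaced d I
    · by_cases h' : nextIndex d I ≤ N
      · rw [if_pos h, if_pos h, if_pos ⟨h, h'⟩, max_eq_left h',
          max_eq_left (h'.trans N.le_succ), max_eq_left (h'.trans (Nat.le_add_right _ _)),
          max_eq_right (by omega), hS N]
        ring
      · rw [if_pos h, if_pos h, if_neg (fun H => h' H.2), max_eq_right (by omega),
          max_eq_right (by omega), add_zero]
    · simp [h]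

open Classical in
theorem tsum_isSpaced {w S : ℕ → ℂ} {d : ℕ → ℕ} (hd : ∀ i, 1 ≤ d i)
    (hS : ∀ i, S i = w i * S (i + d i) + S (i + 1)) (hw : Summable fun i => ‖w i‖)
    {C : ℝ} (hC : ∀ i, ‖S i‖ ≤ C) (hlim : Filter.Tendsto S Filter.atTop (nhds 1)) :
    ∑' I : {I : Finset ℕ // IsSpaced d I}, ∏ i ∈ I.1, w i = S 0 := by
  have hsum : Summable fun I : Finset ℕ => (∏ i ∈ I, ‖w i‖) * C :=
    (summable_finsetProd_of_summable_nonneg (fun i => norm_nonneg (w i)) hw).mul_right C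
  have key := tendsto_tsum_of_dominated_convergence (𝓕 := Filter.atTop)
    (f := fun (N : ℕ) (I : Finset ℕ) => if I ∈ (Finset.range N).powerset then
      (if IsSpaced d I then (∏ i ∈ I, w i) * S (max N (nextIndex d I)) else 0) else 0)
    (g := fun I => if IsSpaced d I then ∏ i ∈ I, w i else 0) hsum ?_ ?_
  · have hconst : ∀ N : ℕ, ∑' I : Finset ℕ, (if I ∈ (Finset.range N).powerset then
        (if IsSpaced d I then (∏ i ∈ I, w i) * S (max N (nextIndex d I)) else 0) else 0)
          = S 0 := by
      intro N
      rw [eq_sum_isSpaced hd hS N, tsum_eq_sum (s := (Finset.range N).powerset)]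
      · exact Finset.sum_congr rfl fun I hI => if_pos hI
      · exact fun I hI => if_neg hI
    simp only [hconst] at key
    rw [tendsto_nhds_unique tendsto_const_nhds key]
    exact tsum_subtype {I : Finset ℕ | IsSpaced d I} fun I => ∏ i ∈ I, w i
  · intro I
    by_cases h : IsSpaced d I
    · have h₁ : Filter.Tendsto (fun N => (∏ i ∈ I, w i) * S (max N (nextIndex d I)))
          Filter.atTop (nhds (∏ i ∈ I, w i)) := by
        simpa using (hlim.comp (Filter.tendsto_atTop_mono (fun N => le_max_left N _)
          Filter.tendsto_id)).const_mul (∏ i ∈ I, w i)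
      simp only [h, if_true]
      refine h₁.congr' ?_
      filter_upwards [Filter.eventually_ge_atTop (I.sup id + 1)] with N hN
      rw [if_pos]
      refine Finset.mem_powerset.2 fun i hi => Finset.mem_range.2 ?_
      have := Finset.le_sup (f := id) hi
      simp only [id] at this
      omega
    · simp [h]
  · refine Filter.Eventually.of_forall fun N I => ?_
    have hnn : 0 ≤ (∏ i ∈ I, ‖w i‖) * C :=
      mul_nonneg (Finset.prod_nonneg fun i _ => norm_nonneg _) ((norm_nonneg _).trans (hC 0))
    split_ifs
    · rw [norm_mul, norm_prod]
      exact mul_le_mul_of_nonneg_left (hC _) (Finset.prod_nonneg fun i _ => norm_nonneg _)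
    · simpa using hnn
    · simpa using hnn

/-- The general term of the multisum, with linear exponents `a, b, c, d`. -/
noncomputable def multisumTerm (q x y₁ y₂ z : ℂ) (a b c d : ℕ) (n : ℕ × ℕ × ℕ × ℕ) : ℂ :=
  x ^ (n.1 + n.2.1 + n.2.2.1 + n.2.2.2) * y₁ ^ n.2.2.1 * y₂ ^ n.2.2.2 * z ^ n.2.1 *
    q ^ (Qform n.1 n.2.1 n.2.2.1 n.2.2.2 + a * n.1 + b * n.2.1 + c * n.2.2.1 + d * n.2.2.2) /
    (qPoch (q ^ 2) (q ^ 2) n.1 * qPoch (q ^ 2) (q ^ 2) n.2.1 *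
      qPoch (q ^ 4) (q ^ 4) n.2.2.1 * qPoch (q ^ 4) (q ^ 4) n.2.2.2)

theorem qPoch_succ (a q : ℂ) (n : ℕ) : qPoch a q (n + 1) = qPoch a q n * (1 - a * q ^ n) :=
  Finset.prod_range_succ _ _

theorem pow_le_norm_qPoch {p : ℂ} {r : ℝ} (hp : ‖p‖ ≤ r) (hr : r < 1) (n : ℕ) :
    (1 - r) ^ n ≤ ‖qPoch p p n‖ := by
  have h : ∀ k ∈ Finset.range n, 1 - r ≤ ‖1 - p * p ^ k‖ := by
    intro k _
    have h₁ : ‖p * p ^ k‖ ≤ r := by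
      rw [norm_mul, norm_pow]
      exact (mul_le_of_le_one_right (norm_nonneg p)
        (pow_le_one₀ (norm_nonneg p) (hp.trans hr.le))).trans hp
    have h₂ := norm_sub_norm_le (1 : ℂ) (p * p ^ k)
    rw [norm_one] at h₂
    linarith
  have := Finset.prod_le_prod (fun _ _ => (sub_pos.2 hr).le) h
  simpa [qPoch, norm_prod] using this

theorem one_sub_mul_pow_ne_zero {p : ℂ} (hp : ‖p‖ < 1) (n : ℕ) : 1 - p * p ^ n ≠ 0 := by
  intro h
  have h₁ : p ^ (n + 1) = 1 := by rw [pow_succ']; exact (sub_eq_zero.1 h).symm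
  have h₂ := congrArg norm h₁
  rw [norm_pow, norm_one] at h₂
  exact (pow_lt_one₀ (norm_nonneg p) hp n.succ_ne_zero).ne h₂

theorem div_eq_mul_div_of_eq {N M D D' c t : ℂ} (ht : t ≠ 0) (hN : N = c * M * t)
    (hD : D' = D * t) : N / D' = c * (M / D) := by
  rw [hN, hD, mul_div_mul_right _ _ ht, mul_div_assoc]

theorem succ_choose_two (n : ℕ) : (n + 1).choose 2 = n + n.choose 2 := by
  rw [Nat.choose_succ_succ' n 1, Nat.choose_one_right]

theorem summable_mul_pow_choose_two {r : ℝ} (h₀ : 0 < r) (h₁ : r < 1) (C : ℝ) (hC : 0 < C) :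
    Summable fun n : ℕ => C ^ n * r ^ n.choose 2 := by
  refine summable_of_ratio_test_tendsto_lt_one (l := 0) one_pos
    (Filter.Eventually.of_forall fun n => by positivity) ?_
  have h := (tendsto_pow_atTop_nhds_zero_of_lt_one h₀.le h₁).const_mul C
  rw [mul_zero] at h
  refine h.congr fun n => ?_
  rw [Real.norm_of_nonneg (by positivity), Real.norm_of_nonneg (by positivity),
    eq_div_iff (by positivity), succ_choose_two]
  ring

section Multisum

variable {q x y₁ y₂ z : ℂ}

theorem multisumTerm_eq_mul (a b c d : ℕ) (n : ℕ × ℕ × ℕ × ℕ) :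
    multisumTerm q x y₁ y₂ z a b c d n = multisumTerm q x y₁ y₂ z 0 0 0 0 n *
      q ^ (a * n.1 + b * n.2.1 + c * n.2.2.1 + d * n.2.2.2) := by
  simp only [multisumTerm]
  ring

theorem norm_multisumTerm_le_zero (hq : ‖q‖ < 1) (a b c d : ℕ) (n : ℕ × ℕ × ℕ × ℕ) :
    ‖multisumTerm q x y₁ y₂ z a b c d n‖ ≤ ‖multisumTerm q x y₁ y₂ z 0 0 0 0 n‖ := by
  rw [multisumTerm_eq_mul, norm_mul, norm_pow]
  exact mul_le_of_le_one_right (norm_nonneg _) (pow_le_one₀ (norm_nonneg q) hq.le)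

theorem summable_norm_multisumTerm_zero (hq : ‖q‖ < 1)
    (hx : ‖x‖ ≤ 1) (hy₁ : ‖y₁‖ ≤ 1) (hy₂ : ‖y₂‖ ≤ 1) (hz : ‖z‖ ≤ 1) :
    Summable fun n => ‖multisumTerm q x y₁ y₂ z 0 0 0 0 n‖ := by
  obtain ⟨r, hqr, hr⟩ := exists_between hq
  have hr₀ : 0 < r := (norm_nonneg q).trans_lt hqr
  have hr' : 0 < 1 - r := sub_pos.2 hr
  set u : ℕ → ℝ := fun n => (1 - r)⁻¹ ^ n * r ^ n.choose 2 with hu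
  have hu₀ : 0 ≤ u := fun n => by simp only [hu, Pi.zero_apply]; positivity
  have hus : Summable u := summable_mul_pow_choose_two hr₀ hr _ (inv_pos.2 hr')
  have h₂ := hus.mul_of_nonneg hus hu₀ hu₀
  have h₂₀ : 0 ≤ fun n : ℕ × ℕ => u n.1 * u n.2 := fun n => mul_nonneg (hu₀ _) (hu₀ _)
  have h₃ := hus.mul_of_nonneg h₂ hu₀ h₂₀
  have h₃₀ : 0 ≤ fun n : ℕ × ℕ × ℕ => u n.1 * (u n.2.1 * u n.2.2) :=
    fun n => mul_nonneg (hu₀ _) (h₂₀ _)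
  refine (hus.mul_of_nonneg h₃ hu₀ h₃₀).of_nonneg_of_le (fun _ => norm_nonneg _) ?_
  rintro ⟨i, j, k, l⟩
  have hpow : ∀ m, m ≠ 0 → ‖q ^ m‖ ≤ r := fun m hm => by
    rw [norm_pow]
    exact (pow_le_of_le_one (norm_nonneg q) hq.le hm).trans hqr.le
  have hone : ∀ {t : ℂ} (m : ℕ), ‖t‖ ≤ 1 → ‖t‖ ^ m ≤ 1 :=
    fun m ht => pow_le_one₀ (norm_nonneg _) ht
  have hQ : ‖q‖ ^ (Qform i j k l + 0 * i + 0 * j + 0 * k + 0 * l) ≤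
      r ^ (i.choose 2 + j.choose 2 + k.choose 2 + l.choose 2) := by
    refine (pow_le_pow_left₀ (norm_nonneg q) hqr.le _).trans
      (pow_le_pow_of_le_one hr₀.le hr.le ?_)
    simp only [Qform]
    omega
  have hP₂ := pow_le_norm_qPoch (hpow 2 two_ne_zero) hr
  have hP₄ := pow_le_norm_qPoch (hpow 4 four_ne_zero) hr
  simp only [multisumTerm, norm_div, norm_mul, norm_pow] at hQ ⊢
  calc _ ≤ (1 * 1 * 1 * 1 * r ^ (i.choose 2 + j.choose 2 + k.choose 2 + l.choose 2)) /
        ((1 - r) ^ i * (1 - r) ^ j * (1 - r) ^ k * (1 - r) ^ l) := by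
        gcongr
        · exact hone _ hx
        · exact hone _ hy₁
        · exact hone _ hy₂
        · exact hone _ hz
        · exact hP₂ i
        · exact hP₂ j
        · exact hP₄ k
        · exact hP₄ l
    _ = _ := by
        simp only [hu, inv_pow]
        field_simp
        ring

theorem summable_multisumTerm (hq : ‖q‖ < 1)
    (hx : ‖x‖ ≤ 1) (hy₁ : ‖y₁‖ ≤ 1) (hy₂ : ‖y₂‖ ≤ 1) (hz : ‖z‖ ≤ 1) (a b c d : ℕ) :
    Summable (multisumTerm q x y₁ y₂ z a b c d) :=
  .of_norm_bounded (summable_norm_multisumTerm_zero hq hx hy₁ hy₂ hz)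
    (norm_multisumTerm_le_zero hq a b c d)

/-- The multisum with linear exponents `a, b, c, d`. -/
noncomputable def multisum (q x y₁ y₂ z : ℂ) (a b c d : ℕ) : ℂ :=
  ∑' n, multisumTerm q x y₁ y₂ z a b c d n

theorem norm_multisum_le (hq : ‖q‖ < 1)
    (hx : ‖x‖ ≤ 1) (hy₁ : ‖y₁‖ ≤ 1) (hy₂ : ‖y₂‖ ≤ 1) (hz : ‖z‖ ≤ 1) (a b c d : ℕ) :
    ‖multisum q x y₁ y₂ z a b c d‖ ≤ ∑' n, ‖multisumTerm q x y₁ y₂ z 0 0 0 0 n‖ :=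
  tsum_of_norm_bounded (summable_norm_multisumTerm_zero hq hx hy₁ hy₂ hz).hasSum
    (norm_multisumTerm_le_zero hq a b c d)

theorem tendsto_multisum (hq : ‖q‖ < 1)
    (hx : ‖x‖ ≤ 1) (hy₁ : ‖y₁‖ ≤ 1) (hy₂ : ‖y₂‖ ≤ 1) (hz : ‖z‖ ≤ 1) {a b c d e : ℕ → ℕ}
    (he : Filter.Tendsto e Filter.atTop Filter.atTop)
    (ha : ∀ i, e i ≤ a i) (hb : ∀ i, e i ≤ b i) (hc : ∀ i, e i ≤ c i) (hd : ∀ i, e i ≤ d i) :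
    Filter.Tendsto (fun i => multisum q x y₁ y₂ z (a i) (b i) (c i) (d i))
      Filter.atTop (nhds 1) := by
  have key := tendsto_tsum_of_dominated_convergence (𝓕 := Filter.atTop)
    (f := fun i n => multisumTerm q x y₁ y₂ z (a i) (b i) (c i) (d i) n)
    (g := fun n => if n = 0 then 1 else 0)
    (summable_norm_multisumTerm_zero hq hx hy₁ hy₂ hz) ?_
    (Filter.Eventually.of_forall fun i n => norm_multisumTerm_le_zero hq _ _ _ _ n)
  · rwa [tsum_ite_eq] at key
  · intro n
    by_cases hn : n = 0
    · simp [hn, multisumTerm, Qform, qPoch]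
    · rw [if_neg hn]
      simp only [multisumTerm_eq_mul (a _)]
      rw [← mul_zero (multisumTerm q x y₁ y₂ z 0 0 0 0 n)]
      refine ((tendsto_pow_atTop_nhds_zero_of_norm_lt_one hq).comp
        (Filter.tendsto_atTop_mono (fun i => ?_) he)).const_mul _
      obtain ⟨j, k, l, m⟩ := n
      have hpos : 1 ≤ j + k + l + m := by
        by_contra h
        exact hn (by simp only [Prod.mk_eq_zero]; omega)
      calc e i ≤ e i * (j + k + l + m) := Nat.le_mul_of_pos_right _ hpos
        _ = e i * j + e i * k + e i * l + e i * m := by ring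
        _ ≤ _ := by gcongr <;> apply_assumption

theorem tsum_eq_mul_add_of_injective {ι : Type*} {f g h : ι → ℂ} {s : ι → ι} {c : ℂ}
    (hf : Summable f) (hg : Summable g) (hs : s.Injective)
    (hrange : ∀ n ∉ Set.range s, f n = g n) (hstep : ∀ n, f (s n) - g (s n) = c * h n) :
    ∑' n, f n = c * ∑' n, h n + ∑' n, g n := by
  rw [← sub_eq_iff_eq_add, ← hf.tsum_sub hg, ← tsum_mul_left, ← hs.tsum_eq]
  · exact tsum_congr hstep
  · intro n hn
    by_contra h
    exact hn (sub_eq_zero.2 (hrange n h))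

theorem multisum_rec_first (hq : ‖q‖ < 1)
    (hx : ‖x‖ ≤ 1) (hy₁ : ‖y₁‖ ≤ 1) (hy₂ : ‖y₂‖ ≤ 1) (hz : ‖z‖ ≤ 1) (a b c d : ℕ) :
    multisum q x y₁ y₂ z a b c d =
      x * q ^ a * multisum q x y₁ y₂ z (a + 4) (b + 4) (c + 4) (d + 4) +
        multisum q x y₁ y₂ z (a + 2) b c d := by
  refine tsum_eq_mul_add_of_injective (s := fun n => (n.1 + 1, n.2))
    (summable_multisumTerm hq hx hy₁ hy₂ hz _ _ _ _)
    (summable_multisumTerm hq hx hy₁ hy₂ hz _ _ _ _) ?_ ?_ ?_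
  · rintro ⟨i, j, k, l⟩ ⟨i', j', k', l'⟩ h
    simpa using h
  · rintro ⟨i, j, k, l⟩ h
    rcases i with _ | i
    · simp [multisumTerm]
    · exact absurd ⟨(i, j, k, l), rfl⟩ h
  · rintro ⟨i, j, k, l⟩
    have hne := one_sub_mul_pow_ne_zero (p := q ^ 2)
      (by rw [norm_pow]; exact pow_lt_one₀ (norm_nonneg q) hq two_ne_zero) i
    simp only [multisumTerm, qPoch_succ, Qform, succ_choose_two]
    rw [← sub_div]
    exact div_eq_mul_div_of_eq hne (by ring) (by ring)

theorem multisum_rec_second (hq : ‖q‖ < 1)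
    (hx : ‖x‖ ≤ 1) (hy₁ : ‖y₁‖ ≤ 1) (hy₂ : ‖y₂‖ ≤ 1) (hz : ‖z‖ ≤ 1) (a b c d : ℕ) :
    multisum q x y₁ y₂ z a b c d =
      x * z * q ^ b * multisum q x y₁ y₂ z (a + 4) (b + 6) (c + 4) (d + 4) +
        multisum q x y₁ y₂ z a (b + 2) c d := by
  refine tsum_eq_mul_add_of_injective (s := fun n => (n.1, n.2.1 + 1, n.2.2))
    (summable_multisumTerm hq hx hy₁ hy₂ hz _ _ _ _)
    (summable_multisumTerm hq hx hy₁ hy₂ hz _ _ _ _) ?_ ?_ ?_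
  · rintro ⟨i, j, k, l⟩ ⟨i', j', k', l'⟩ h
    simpa using h
  · rintro ⟨i, j, k, l⟩ h
    rcases j with _ | j
    · simp [multisumTerm]
    · exact absurd ⟨(i, j, k, l), rfl⟩ h
  · rintro ⟨i, j, k, l⟩
    have hne := one_sub_mul_pow_ne_zero (p := q ^ 2)
      (by rw [norm_pow]; exact pow_lt_one₀ (norm_nonneg q) hq two_ne_zero) j
    simp only [multisumTerm, qPoch_succ, Qform, succ_choose_two]
    rw [← sub_div]
    exact div_eq_mul_div_of_eq hne (by ring) (by ring)

theorem multisum_rec_third (hq : ‖q‖ < 1)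
    (hx : ‖x‖ ≤ 1) (hy₁ : ‖y₁‖ ≤ 1) (hy₂ : ‖y₂‖ ≤ 1) (hz : ‖z‖ ≤ 1) (a b c d : ℕ) :
    multisum q x y₁ y₂ z a b c d =
      x * y₁ * q ^ c * multisum q x y₁ y₂ z (a + 4) (b + 4) (c + 4) (d + 4) +
        multisum q x y₁ y₂ z a b (c + 4) d := by
  refine tsum_eq_mul_add_of_injective (s := fun n => (n.1, n.2.1, n.2.2.1 + 1, n.2.2.2))
    (summable_multisumTerm hq hx hy₁ hy₂ hz _ _ _ _)
    (summable_multisumTerm hq hx hy₁ hy₂ hz _ _ _ _) ?_ ?_ ?_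
  · rintro ⟨i, j, k, l⟩ ⟨i', j', k', l'⟩ h
    simpa using h
  · rintro ⟨i, j, k, l⟩ h
    rcases k with _ | k
    · simp [multisumTerm]
    · exact absurd ⟨(i, j, k, l), rfl⟩ h
  · rintro ⟨i, j, k, l⟩
    have hne := one_sub_mul_pow_ne_zero (p := q ^ 4)
      (by rw [norm_pow]; exact pow_lt_one₀ (norm_nonneg q) hq four_ne_zero) k
    simp only [multisumTerm, qPoch_succ, Qform, succ_choose_two]
    rw [← sub_div]
    exact div_eq_mul_div_of_eq hne (by ring) (by ring)

theorem multisum_rec_fourth (hq : ‖q‖ < 1)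
    (hx : ‖x‖ ≤ 1) (hy₁ : ‖y₁‖ ≤ 1) (hy₂ : ‖y₂‖ ≤ 1) (hz : ‖z‖ ≤ 1) (a b c d : ℕ) :
    multisum q x y₁ y₂ z a b c d =
      x * y₂ * q ^ d * multisum q x y₁ y₂ z (a + 4) (b + 4) (c + 4) (d + 8) +
        multisum q x y₁ y₂ z a b c (d + 4) := by
  refine tsum_eq_mul_add_of_injective (s := fun n => (n.1, n.2.1, n.2.2.1, n.2.2.2 + 1))
    (summable_multisumTerm hq hx hy₁ hy₂ hz _ _ _ _)
    (summable_multisumTerm hq hx hy₁ hy₂ hz _ _ _ _) ?_ ?_ ?_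
  · rintro ⟨i, j, k, l⟩ ⟨i', j', k', l'⟩ h
    simpa using h
  · rintro ⟨i, j, k, l⟩ h
    rcases l with _ | l
    · simp [multisumTerm]
    · exact absurd ⟨(i, j, k, l), rfl⟩ h
  · rintro ⟨i, j, k, l⟩
    have hne := one_sub_mul_pow_ne_zero (p := q ^ 4)
      (by rw [norm_pow]; exact pow_lt_one₀ (norm_nonneg q) hq four_ne_zero) l
    simp only [multisumTerm, qPoch_succ, Qform, succ_choose_two]
    rw [← sub_div]
    exact div_eq_mul_div_of_eq hne (by ring) (by ring)

end Multisum

/-- The size of the `i`-th admissible part in the list `3, 4, 5̄, 5, 6, 7̄, 7, 8, 9̄, 9, …`. -/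
def partSize (i : ℕ) : ℕ := 3 + i - i / 3

/-- The least distance from `i` to a later index allowed by the gap conditions of `MemA`. -/
def partGap (i : ℕ) : ℕ := if i % 6 = 1 ∨ i % 3 = 2 then 7 else 6

/-- The weight of the `i`-th admissible part, which is overlined exactly if `i % 3 = 2`. -/
noncomputable def partWeight (q x y₁ y₂ z : ℂ) (i : ℕ) : ℂ :=
  x * (if partSize i % 4 = 2 then y₁ else 1) * (if partSize i % 4 = 0 then y₂ else 1) *
    (if i % 3 = 2 then z else 1) * q ^ partSize i

theorem add_partGap_le_iff {i j : ℕ} (h : i < j) : i + partGap i ≤ j ↔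
    partSize i < partSize j ∧ 4 ≤ partSize j - partSize i ∧
      (j % 3 = 2 ∨ 4 ∣ partSize j → 5 ≤ partSize j - partSize i) := by
  simp only [partGap, partSize]
  split_ifs <;> omega

theorem lt_of_partSize_lt {i j : ℕ} (h : partSize i < partSize j) : i < j := by
  simp only [partSize] at h
  omega

theorem eq_of_partSize_eq {i j : ℕ} (h : partSize i = partSize j)
    (h' : i % 3 = 2 ↔ j % 3 = 2) : i = j := by
  simp only [partSize] at h
  omega

theorem exists_partSize_eq {p : ℕ} {o : Prop} (hp : 3 ≤ p) (ho : o → Odd p ∧ p ≠ 3) :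
    ∃ i, partSize i = p ∧ (i % 3 = 2 ↔ o) := by
  by_cases h : o
  · obtain ⟨⟨k, hk⟩, h₃⟩ := ho h
    exact ⟨3 * k - 4, by simp only [partSize]; omega, by simp only [h, iff_true]; omega⟩
  · refine ⟨(p - 3) + (p - 3) / 2, by simp only [partSize]; omega, ?_⟩
    simp only [h, iff_false]
    omega

theorem IsSpaced.partSize_injOn {I : Finset ℕ} (hI : IsSpaced partGap I) :
    Set.InjOn partSize I := by
  intro i hi j hj hij
  rcases lt_trichotomy i j with h | h | h
  · have := ((add_partGap_le_iff h).1 (hI i hi j hj h)).1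
    omega
  · exact h
  · have := ((add_partGap_le_iff h).1 (hI j hj i hi h)).1
    omega

/-- The overpartition whose parts have indices in `I`. -/
def toOverpartition (I : Finset ℕ) : Finset ℕ × Finset ℕ :=
  (I.image partSize, (I.filter fun i => i % 3 = 2).image partSize)

theorem IsSpaced.partSize_mem_snd_iff {I : Finset ℕ} (hI : IsSpaced partGap I) {i : ℕ}
    (hi : i ∈ I) : partSize i ∈ (toOverpartition I).2 ↔ i % 3 = 2 := by
  simp only [toOverpartition, Finset.mem_image, Finset.mem_filter]
  constructor
  · rintro ⟨j, ⟨hj, ho⟩, hij⟩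
    rwa [← hI.partSize_injOn hj hi hij]
  · exact fun h => ⟨i, ⟨hi, h⟩, rfl⟩

theorem IsSpaced.mem_iff {I : Finset ℕ} (hI : IsSpaced partGap I) {i : ℕ} :
    i ∈ I ↔ partSize i ∈ (toOverpartition I).1 ∧
      (i % 3 = 2 ↔ partSize i ∈ (toOverpartition I).2) := by
  constructor
  · exact fun hi => ⟨Finset.mem_image_of_mem _ hi, (hI.partSize_mem_snd_iff hi).symm⟩
  · rintro ⟨h₁, h₂⟩
    obtain ⟨j, hj, hij⟩ := Finset.mem_image.1 h₁
    rw [← hij, hI.partSize_mem_snd_iff hj] at h₂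
    rwa [← eq_of_partSize_eq hij h₂.symm]

/-- Membership in `𝒜` with the parts `1`, `1̄`, `2`, `3̄` forbidden. -/
def MemRestrictedA (p : Finset ℕ × Finset ℕ) : Prop :=
  MemA p.1 p.2 ∧ 1 ∉ p.1 ∧ 2 ∉ p.1 ∧ 3 ∉ p.2

theorem IsSpaced.memRestrictedA {I : Finset ℕ} (hI : IsSpaced partGap I) :
    MemRestrictedA (toOverpartition I) := by
  have hsize : ∀ p ∈ (toOverpartition I).1, 3 ≤ p := by
    intro p hp
    obtain ⟨i, _, rfl⟩ := Finset.mem_image.1 hp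
    simp only [partSize]
    omega
  have hover : ∀ p ∈ (toOverpartition I).2, Odd p ∧ 3 < p := by
    intro p hp
    obtain ⟨i, hi, rfl⟩ := Finset.mem_image.1 hp
    have := (Finset.mem_filter.1 hi).2
    rw [Nat.odd_iff]
    simp only [partSize]
    omega
  refine ⟨⟨fun p hp => by have := hsize p hp; omega,
    Finset.image_subset_image (Finset.filter_subset _ _), fun p hp => (hover p hp).1, ?_⟩,
    fun h => absurd (hsize _ h) (by omega), fun h => absurd (hsize _ h) (by omega),
    fun h => absurd (hover _ h).2 (by omega)⟩
  intro a ha b hb hab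
  obtain ⟨j, hj, rfl⟩ := Finset.mem_image.1 ha
  obtain ⟨i, hi, rfl⟩ := Finset.mem_image.1 hb
  have hij := lt_of_partSize_lt hab
  rw [hI.partSize_mem_snd_iff hj]
  exact ((add_partGap_le_iff hij).1 (hI i hi j hj hij)).2

theorem exists_isSpaced_toOverpartition_eq {p : Finset ℕ × Finset ℕ} (hp : MemRestrictedA p) :
    ∃ I, IsSpaced partGap I ∧ toOverpartition I = p := by
  obtain ⟨P, O⟩ := p
  obtain ⟨⟨hpos, hsub, hodd, hgap⟩, h₁, h₂, h₃⟩ := hp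
  dsimp only at hpos hsub hodd hgap h₁ h₂ h₃
  have hex : ∀ p ∈ P, ∃ i, partSize i = p ∧ (i % 3 = 2 ↔ p ∈ O) := by
    intro p hp
    refine exists_partSize_eq ?_ fun ho => ⟨hodd p ho, fun h => h₃ (h ▸ ho)⟩
    have := hpos p hp
    have : p ≠ 1 := fun h => h₁ (h ▸ hp)
    have : p ≠ 2 := fun h => h₂ (h ▸ hp)
    omega
  set I := (Finset.range (2 * P.sup id + 1)).filter fun i =>
    partSize i ∈ P ∧ (i % 3 = 2 ↔ partSize i ∈ O) with hI
  have hmem : ∀ i, i ∈ I ↔ partSize i ∈ P ∧ (i % 3 = 2 ↔ partSize i ∈ O) := by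
    intro i
    rw [hI, Finset.mem_filter, Finset.mem_range, and_iff_right_iff_imp]
    rintro ⟨h, -⟩
    have := Finset.le_sup (f := id) h
    simp only [partSize, id] at this
    omega
  refine ⟨I, ?_, ?_⟩
  · intro i hi j hj hij
    rw [hmem] at hi hj
    have hlt : partSize i < partSize j := by
      refine lt_of_le_of_ne (by simp only [partSize]; omega) fun h => hij.ne ?_
      exact eq_of_partSize_eq h (by rw [hi.2, hj.2, h])
    rw [add_partGap_le_iff hij, hj.2]
    exact ⟨hlt, hgap _ hj.1 _ hi.1 hlt⟩
  · refine Prod.ext (Finset.ext fun p => ?_) (Finset.ext fun p => ?_) <;>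
      simp only [toOverpartition, Finset.mem_image, Finset.mem_filter, hmem]
    · constructor
      · rintro ⟨i, hi, rfl⟩
        exact hi.1
      · intro hp
        obtain ⟨i, rfl, ho⟩ := hex p hp
        exact ⟨i, ⟨hp, ho⟩, rfl⟩
    · constructor
      · rintro ⟨i, hi, rfl⟩
        exact hi.1.2.1 hi.2
      · intro hp
        obtain ⟨i, rfl, ho⟩ := hex p (hsub hp)
        exact ⟨i, ⟨⟨hsub hp, ho⟩, ho.2 hp⟩, rfl⟩

/-- Spaced index sets correspond to the overpartitions counted on the left-hand side. -/
noncomputable def spacedEquiv :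
    {I : Finset ℕ // IsSpaced partGap I} ≃ {p : Finset ℕ × Finset ℕ // MemRestrictedA p} :=
  Equiv.ofBijective (fun I => ⟨toOverpartition I.1, I.2.memRestrictedA⟩) <| by
    constructor
    · rintro ⟨I, hI⟩ ⟨J, hJ⟩ h
      have h : toOverpartition I = toOverpartition J := congrArg Subtype.val h
      exact Subtype.ext (Finset.ext fun i => by rw [hI.mem_iff, hJ.mem_iff, h])
    · rintro ⟨p, hp⟩
      obtain ⟨I, hI, rfl⟩ := exists_isSpaced_toOverpartition_eq hp
      exact ⟨⟨I, hI⟩, rfl⟩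

theorem IsSpaced.weight_eq_prod {I : Finset ℕ} (hI : IsSpaced partGap I) (q x y₁ y₂ z : ℂ) :
    x ^ (toOverpartition I).1.card * y₁ ^ countMod 2 4 (toOverpartition I).1 *
      y₂ ^ countMod 0 4 (toOverpartition I).1 * z ^ (toOverpartition I).2.card *
        q ^ (toOverpartition I).1.sum id = ∏ i ∈ I, partWeight q x y₁ y₂ z i := by
  have hcard : ∀ {J : Finset ℕ}, J ⊆ I → (J.image partSize).card = J.card := fun hJ =>
    Finset.card_image_of_injOn (hI.partSize_injOn.mono hJ)
  simp only [partWeight, Finset.prod_mul_distrib, Finset.prod_const, Finset.prod_ite, one_pow,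
    mul_one, Finset.prod_pow_eq_pow_sum, countMod, toOverpartition, Finset.filter_image]
  rw [hcard subset_rfl, hcard (Finset.filter_subset _ _), hcard (Finset.filter_subset _ _),
    hcard (Finset.filter_subset _ _), Finset.sum_image hI.partSize_injOn]
  rfl

section Weight

variable {q x y₁ y₂ z : ℂ}

theorem summable_norm_partWeight (hq : ‖q‖ < 1)
    (hx : ‖x‖ ≤ 1) (hy₁ : ‖y₁‖ ≤ 1) (hy₂ : ‖y₂‖ ≤ 1) (hz : ‖z‖ ≤ 1) :
    Summable fun i => ‖partWeight q x y₁ y₂ z i‖ := by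
  obtain ⟨r, hqr, hr⟩ := exists_between hq
  have hr₀ : 0 < r := (norm_nonneg q).trans_lt hqr
  have hite : ∀ (P : Prop) [Decidable P] {t : ℂ}, ‖t‖ ≤ 1 → ‖if P then t else 1‖ ≤ 1 := by
    intro P _ t ht
    split_ifs
    · exact ht
    · exact norm_one.le
  have hs : Real.sqrt r < 1 := (Real.sqrt_lt' one_pos).2 (by simpa using hr)
  refine (summable_geometric_of_lt_one (Real.sqrt_nonneg r) hs).of_nonneg_of_le
    (fun _ => norm_nonneg _) fun i => ?_
  simp only [partWeight, norm_mul, norm_pow]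
  calc _ ≤ 1 * 1 * 1 * 1 * r ^ partSize i := by
        gcongr
        · exact hite _ hy₁
        · exact hite _ hy₂
        · exact hite _ hz
    _ = Real.sqrt r ^ (2 * partSize i) := by rw [pow_mul, Real.sq_sqrt hr₀.le]; ring
    _ ≤ Real.sqrt r ^ i :=
        pow_le_pow_of_le_one (Real.sqrt_nonneg r) hs.le (by simp only [partSize]; omega)

/-- The multisum attached to the overpartitions all of whose parts have index at least `i`. -/
noncomputable def tailMultisum (q x y₁ y₂ z : ℂ) (i : ℕ) : ℂ :=
  multisum q x y₁ y₂ z (3 + 2 * ((i + 2) / 3)) (5 + 2 * (i / 3)) (6 + 4 * ((i + 1) / 6))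
    (4 + 4 * ((i + 4) / 6))

theorem tailMultisum_rec (hq : ‖q‖ < 1)
    (hx : ‖x‖ ≤ 1) (hy₁ : ‖y₁‖ ≤ 1) (hy₂ : ‖y₂‖ ≤ 1) (hz : ‖z‖ ≤ 1) (i : ℕ) :
    tailMultisum q x y₁ y₂ z i =
      partWeight q x y₁ y₂ z i * tailMultisum q x y₁ y₂ z (i + partGap i) +
        tailMultisum q x y₁ y₂ z (i + 1) := by
  have hcases : i % 3 = 0 ∨ i % 3 = 2 ∨ i % 6 = 4 ∨ i % 6 = 1 := by omega
  rcases hcases with h | h | h | h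
  · have hgap : partGap i = 6 := by simp only [partGap]; split_ifs <;> omega
    have hw : partWeight q x y₁ y₂ z i = x * q ^ (3 + 2 * ((i + 2) / 3)) := by
      rw [partWeight, if_neg (by simp only [partSize]; omega),
        if_neg (by simp only [partSize]; omega), if_neg (by omega),
        show partSize i = 3 + 2 * ((i + 2) / 3) by simp only [partSize]; omega]
      ring
    rw [hgap, hw]
    simp only [tailMultisum]
    rw [multisum_rec_first hq hx hy₁ hy₂ hz]
    congr 1
    · congr 2 <;> omega
    · congr 1 <;> omega
  · have hgap : partGap i = 7 := by simp only [partGap]; split_ifs <;> omega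
    have hw : partWeight q x y₁ y₂ z i = x * z * q ^ (5 + 2 * (i / 3)) := by
      rw [partWeight, if_neg (by simp only [partSize]; omega),
        if_neg (by simp only [partSize]; omega), if_pos h,
        show partSize i = 5 + 2 * (i / 3) by simp only [partSize]; omega]
      ring
    rw [hgap, hw]
    simp only [tailMultisum]
    rw [multisum_rec_second hq hx hy₁ hy₂ hz]
    congr 1
    · congr 2 <;> omega
    · congr 1 <;> omega
  · have hgap : partGap i = 6 := by simp only [partGap]; split_ifs <;> omega
    have hw : partWeight q x y₁ y₂ z i = x * y₁ * q ^ (6 + 4 * ((i + 1) / 6)) := by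
      rw [partWeight, if_pos (by simp only [partSize]; omega),
        if_neg (by simp only [partSize]; omega), if_neg (by omega),
        show partSize i = 6 + 4 * ((i + 1) / 6) by simp only [partSize]; omega]
      ring
    rw [hgap, hw]
    simp only [tailMultisum]
    rw [multisum_rec_third hq hx hy₁ hy₂ hz]
    congr 1
    · congr 2 <;> omega
    · congr 1 <;> omega
  · have hgap : partGap i = 7 := by simp only [partGap]; split_ifs <;> omega
    have hw : partWeight q x y₁ y₂ z i = x * y₂ * q ^ (4 + 4 * ((i + 4) / 6)) := by
      rw [partWeight, if_neg (by simp only [partSize]; omega),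
        if_pos (by simp only [partSize]; omega), if_neg (by omega),
        show partSize i = 4 + 4 * ((i + 4) / 6) by simp only [partSize]; omega]
      ring
    rw [hgap, hw]
    simp only [tailMultisum]
    rw [multisum_rec_fourth hq hx hy₁ hy₂ hz]
    congr 1
    · congr 2 <;> omega
    · congr 1 <;> omega

theorem tsum_spaced_eq_multisum (hq : ‖q‖ < 1)
    (hx : ‖x‖ ≤ 1) (hy₁ : ‖y₁‖ ≤ 1) (hy₂ : ‖y₂‖ ≤ 1) (hz : ‖z‖ ≤ 1) :
    ∑' I : {I : Finset ℕ // IsSpaced partGap I}, ∏ i ∈ I.1, partWeight q x y₁ y₂ z i =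
      multisum q x y₁ y₂ z 3 5 6 4 :=
  tsum_isSpaced (S := tailMultisum q x y₁ y₂ z)
    (fun i => by simp only [partGap]; split_ifs <;> omega)
    (tailMultisum_rec hq hx hy₁ hy₂ hz) (summable_norm_partWeight hq hx hy₁ hy₂ hz)
    (fun _ => norm_multisum_le hq hx hy₁ hy₂ hz _ _ _ _)
    (tendsto_multisum hq hx hy₁ hy₂ hz (e := fun i => i / 2)
      (Filter.tendsto_atTop_atTop.2 fun b => ⟨2 * b, fun i hi => by omega⟩)
      (fun i => by omega) (fun i => by omega) (fun i => by omega) (fun i => by omega))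

end Weight

/-- The quinvariate generating function for `𝒜` for `𝒜_{1,1̄,2,3̄}` (the parts `1`, `1̄`, `2`, `3̄` forbidden; fourth identity of Theorem 5.1). -/
theorem genfun_A_restricted (q x y₁ y₂ z : ℂ) (hq : ‖q‖ < 1)
    (hx : ‖x‖ ≤ 1) (hy₁ : ‖y₁‖ ≤ 1) (hy₂ : ‖y₂‖ ≤ 1) (hz : ‖z‖ ≤ 1) :
    Summable (fun lam : {p : Finset ℕ × Finset ℕ // MemA p.1 p.2 ∧ 1 ∉ p.1 ∧ 2 ∉ p.1 ∧ 3 ∉ p.2} =>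
      x ^ lam.1.1.card * y₁ ^ countMod 2 4 lam.1.1 * y₂ ^ countMod 0 4 lam.1.1 *
        z ^ lam.1.2.card * q ^ lam.1.1.sum id) ∧
    Summable (fun n : ℕ × ℕ × ℕ × ℕ =>
      x ^ (n.1 + n.2.1 + n.2.2.1 + n.2.2.2) * y₁ ^ n.2.2.1 * y₂ ^ n.2.2.2 * z ^ n.2.1 *
        q ^ (Qform n.1 n.2.1 n.2.2.1 n.2.2.2 + 3 * n.1 + 5 * n.2.1 + 6 * n.2.2.1 + 4 * n.2.2.2) /
        (qPoch (q ^ 2) (q ^ 2) n.1 * qPoch (q ^ 2) (q ^ 2) n.2.1 *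
          qPoch (q ^ 4) (q ^ 4) n.2.2.1 * qPoch (q ^ 4) (q ^ 4) n.2.2.2)) ∧
    ∑' lam : {p : Finset ℕ × Finset ℕ // MemA p.1 p.2 ∧ 1 ∉ p.1 ∧ 2 ∉ p.1 ∧ 3 ∉ p.2},
        x ^ lam.1.1.card * y₁ ^ countMod 2 4 lam.1.1 * y₂ ^ countMod 0 4 lam.1.1 *
          z ^ lam.1.2.card * q ^ lam.1.1.sum id =
      ∑' n : ℕ × ℕ × ℕ × ℕ,
        x ^ (n.1 + n.2.1 + n.2.2.1 + n.2.2.2) * y₁ ^ n.2.2.1 * y₂ ^ n.2.2.2 * z ^ n.2.1 *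
          q ^ (Qform n.1 n.2.1 n.2.2.1 n.2.2.2 + 3 * n.1 + 5 * n.2.1 + 6 * n.2.2.1 + 4 * n.2.2.2) /
          (qPoch (q ^ 2) (q ^ 2) n.1 * qPoch (q ^ 2) (q ^ 2) n.2.1 *
            qPoch (q ^ 4) (q ^ 4) n.2.2.1 * qPoch (q ^ 4) (q ^ 4) n.2.2.2) := by
  have hweight : ∀ I : {I : Finset ℕ // IsSpaced partGap I}, _ :=
    fun I => I.2.weight_eq_prod q x y₁ y₂ z
  refine ⟨?_, summable_multisumTerm hq hx hy₁ hy₂ hz 3 5 6 4, ?_⟩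
  · refine spacedEquiv.summable_iff.1 ?_
    refine Summable.congr ?_ fun I => (hweight I).symm
    have hs := summable_finsetProd_of_summable_norm (summable_norm_partWeight hq hx hy₁ hy₂ hz)
    exact hs.subtype _
  · refine (spacedEquiv.tsum_eq _).symm.trans ((tsum_congr hweight).trans ?_)
    exact tsum_spaced_eq_multisum hq hx hy₁ hy₂ hz
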